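/- arXiv:2411.11136 — 3 statements merged into one kernel-verified Lean document; each statement's English description precedes it below -/
import Mathlib

section
/- Let G be a finite simple graph, let k > t ≥ 2 be integers, and let Q0 be a Revise-stable optimal k^−-star packing of G. Then for every star S of Q0 with exactly t satellites, for every satellite v of S, every neighbor u of v in G with u ∉ V(S) satisfies: u is the center of a star of Q0 having exactly t−1 or exactly k satellites, or else t = 2 and u belongs to a star of Q0 having exactly one satellite. -/
open SimpleGraph

variable {V : Type*}

/-- A star in a graph `G`: a center together with a finite set of satellites, each
adjacent to the center.  An `ℓ`-star is such a star with `sats.card = ℓ`. -/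
structure GStar (G : SimpleGraph V) where
  center : V
  sats : Finset V
  center_not_mem : center ∉ sats
  adj : ∀ v ∈ sats, G.Adj center v

/-- The vertex set of a star. -/
def GStar.verts {G : SimpleGraph V} (S : GStar G) : Set V :=
  insert S.center ↑S.sats

/-- The set of vertices covered by a collection of stars. -/
def coverSet {G : SimpleGraph V} (P : Set (GStar G)) : Set V :=
  ⋃ S ∈ P, S.verts

/-- A `k⁻`-star packing: pairwise vertex-disjoint `ℓ`-stars with `1 ≤ ℓ ≤ k`. -/
def IsKMinusPacking {G : SimpleGraph V} (k : ℕ) (Q : Set (GStar G)) : Prop :=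
  (∀ S ∈ Q, 1 ≤ S.sats.card ∧ S.sats.card ≤ k) ∧
  Q.Pairwise fun S T => Disjoint S.verts T.verts

/-- An optimal `k⁻`-star packing: one covering the maximum possible number of vertices. -/
def IsOptimalKMinusPacking {G : SimpleGraph V} (k : ℕ) (Q : Set (GStar G)) : Prop :=
  IsKMinusPacking k Q ∧
  ∀ Q' : Set (GStar G), IsKMinusPacking k Q' → (coverSet Q').ncard ≤ (coverSet Q).ncard

/-- A `k⁻/t`-star packing: pairwise vertex-disjoint `ℓ`-stars with `1 ≤ ℓ ≤ k`, `ℓ ≠ t`. -/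
def IsKtPacking {G : SimpleGraph V} (k t : ℕ) (Q : Set (GStar G)) : Prop :=
  (∀ S ∈ Q, 1 ≤ S.sats.card ∧ S.sats.card ≤ k ∧ S.sats.card ≠ t) ∧
  Q.Pairwise fun S T => Disjoint S.verts T.verts

/-- An optimal `k⁻/t`-star packing. -/
def IsOptimalKtPacking {G : SimpleGraph V} (k t : ℕ) (Q : Set (GStar G)) : Prop :=
  IsKtPacking k t Q ∧
  ∀ Q' : Set (GStar G), IsKtPacking k t Q' → (coverSet Q').ncard ≤ (coverSet Q).ncard

/-- A legal star for a `k⁻`-packing: `1 ≤ ℓ ≤ k` satellites. -/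
def OkStar {G : SimpleGraph V} (k : ℕ) (S : GStar G) : Prop :=
  1 ≤ S.sats.card ∧ S.sats.card ≤ k

/-- `W` can be partitioned into the vertex sets of two vertex-disjoint `ℓ`-stars of `G`
with `1 ≤ ℓ ≤ k`, neither of which has exactly `t` satellites. -/
def SplitsInto2NoT (G : SimpleGraph V) (k t : ℕ) (W : Set V) : Prop :=
  ∃ A B : GStar G, OkStar k A ∧ OkStar k B ∧ A.sats.card ≠ t ∧ B.sats.card ≠ t ∧
    Disjoint A.verts B.verts ∧ A.verts ∪ B.verts = W

/-- `W` can be partitioned into the vertex sets of three pairwise vertex-disjoint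
`ℓ`-stars of `G` with `1 ≤ ℓ ≤ k`, at most one of which has exactly `t` satellites. -/
def SplitsInto3AtMostOneT (G : SimpleGraph V) (k t : ℕ) (W : Set V) : Prop :=
  ∃ A B C : GStar G, OkStar k A ∧ OkStar k B ∧ OkStar k C ∧
    Disjoint A.verts B.verts ∧ Disjoint A.verts C.verts ∧ Disjoint B.verts C.verts ∧
    A.verts ∪ B.verts ∪ C.verts = W ∧
    ¬(A.sats.card = t ∧ B.sats.card = t) ∧ ¬(A.sats.card = t ∧ C.sats.card = t) ∧
    ¬(B.sats.card = t ∧ C.sats.card = t)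

/-- `W` can be partitioned into the vertex sets of three pairwise vertex-disjoint
`ℓ`-stars of `G` with `1 ≤ ℓ ≤ k`, none of which has exactly `t` satellites. -/
def SplitsInto3NoT (G : SimpleGraph V) (k t : ℕ) (W : Set V) : Prop :=
  ∃ A B C : GStar G, OkStar k A ∧ OkStar k B ∧ OkStar k C ∧
    A.sats.card ≠ t ∧ B.sats.card ≠ t ∧ C.sats.card ≠ t ∧
    Disjoint A.verts B.verts ∧ Disjoint A.verts C.verts ∧ Disjoint B.verts C.verts ∧
    A.verts ∪ B.verts ∪ C.verts = W

/-- A `k⁻`-star packing `Q0` is Revise-stable (conditions (R1), (R2), (R3)). -/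
def ReviseStable (G : SimpleGraph V) (k t : ℕ) (Q0 : Set (GStar G)) : Prop :=
  (3 ≤ t → ∀ S ∈ Q0, S.sats.card = t →
    ¬ ∃ A B : GStar G, A.sats.card = t - 2 ∧ B.sats.card = 1 ∧
        Disjoint A.verts B.verts ∧ A.verts ∪ B.verts = S.verts) ∧
  (∀ S ∈ Q0, S.sats.card = t → ∀ S' ∈ Q0, S' ≠ S →
    ¬ SplitsInto2NoT G k t (S.verts ∪ S'.verts) ∧
    ¬ SplitsInto3AtMostOneT G k t (S.verts ∪ S'.verts)) ∧
  (∀ S ∈ Q0, ∀ T ∈ Q0, S ≠ T → S.sats.card = t → T.sats.card = t →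
    ∀ S' ∈ Q0, S' ≠ S → S' ≠ T →
      (S'.sats.card = 1 ∨ S'.sats.card = t - 1 ∨ S'.sats.card = t + 1) →
      ¬ SplitsInto2NoT G k t (S.verts ∪ T.verts ∪ S'.verts) ∧
      ¬ SplitsInto3NoT G k t (S.verts ∪ T.verts ∪ S'.verts))

namespace GStar

variable {G : SimpleGraph V}

lemma mem_verts {S : GStar G} {x : V} : x ∈ S.verts ↔ x = S.center ∨ x ∈ S.sats := by
  simp [GStar.verts]

open Classical in
/-- The star obtained by deleting a vertex from the satellites. -/
noncomputable def eraseSat (S : GStar G) (v : V) : GStar G where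
  center := S.center
  sats := S.sats.erase v
  center_not_mem h := S.center_not_mem (Finset.mem_of_mem_erase h)
  adj w hw := S.adj w (Finset.mem_of_mem_erase hw)

open Classical in
/-- The star obtained by adding a neighbor of the center to the satellites. -/
noncomputable def insertSat (S : GStar G) (v : V) (h : G.Adj S.center v) : GStar G where
  center := S.center
  sats := insert v S.sats
  center_not_mem hc := (Finset.mem_insert.1 hc).elim h.ne S.center_not_mem
  adj w hw := (Finset.mem_insert.1 hw).elim (fun e => e ▸ h) (S.adj w)

/-- The `1`-star on an edge, centered at the first endpoint. -/
def ofAdj (u v : V) (h : G.Adj u v) : GStar G where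
  center := u
  sats := {v}
  center_not_mem hu := h.ne (Finset.mem_singleton.1 hu)
  adj w hw := by rwa [Finset.mem_singleton.1 hw]

lemma card_eraseSat {S : GStar G} {v : V} (hv : v ∈ S.sats) :
    (S.eraseSat v).sats.card = S.sats.card - 1 := by
  classical
  simp only [eraseSat]
  exact Finset.card_erase_of_mem hv

lemma card_insertSat {S : GStar G} {v : V} (h : G.Adj S.center v) (hv : v ∉ S.sats) :
    (S.insertSat v h).sats.card = S.sats.card + 1 := by
  classical
  simp only [insertSat]
  exact Finset.card_insert_of_notMem hv

@[simp]
lemma card_ofAdj {u v : V} (h : G.Adj u v) : (ofAdj u v h).sats.card = 1 := rfl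

lemma mem_verts_eraseSat {S : GStar G} {v : V} (hv : v ∈ S.sats) {x : V} :
    x ∈ (S.eraseSat v).verts ↔ x ∈ S.verts ∧ x ≠ v := by
  have hc : S.center ≠ v := fun e => S.center_not_mem (e ▸ hv)
  simp only [mem_verts, eraseSat, Finset.mem_erase]
  grind

lemma mem_verts_insertSat {S : GStar G} {v : V} (h : G.Adj S.center v) {x : V} :
    x ∈ (S.insertSat v h).verts ↔ x ∈ S.verts ∨ x = v := by
  simp only [mem_verts, insertSat, Finset.mem_insert]
  tauto

lemma mem_verts_ofAdj {u v : V} (h : G.Adj u v) {x : V} :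
    x ∈ (ofAdj u v h).verts ↔ x = u ∨ x = v := by
  simp [mem_verts, ofAdj]

lemma verts_eraseSat {S : GStar G} {v : V} (hv : v ∈ S.sats) :
    (S.eraseSat v).verts = S.verts \ {v} :=
  Set.ext fun _ => mem_verts_eraseSat hv

lemma verts_insertSat {S : GStar G} {v : V} (h : G.Adj S.center v) :
    (S.insertSat v h).verts = S.verts ∪ {v} :=
  Set.ext fun _ => mem_verts_insertSat h

lemma verts_ofAdj {u v : V} (h : G.Adj u v) : (ofAdj u v h).verts = {u, v} :=
  Set.ext fun _ => mem_verts_ofAdj h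

/-- A satellite `v` of `S` may be moved to a disjoint star whose center is adjacent to `v`. -/
lemma splitsInto2NoT_of_adj_center {k t : ℕ} (ht : 2 ≤ t) (htk : t < k) {S T : GStar G}
    (hS : S.sats.card = t) (hT : T.sats.card < k) (hT' : T.sats.card ≠ t - 1)
    (hd : Disjoint S.verts T.verts) {v : V} (hv : v ∈ S.sats) (h : G.Adj T.center v) :
    SplitsInto2NoT G k t (S.verts ∪ T.verts) := by
  have hvS : v ∈ S.verts := mem_verts.2 (.inr hv)
  have hvT : v ∉ T.verts := Set.disjoint_left.1 hd hvS
  have hA := card_eraseSat hv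
  have hB := card_insertSat h fun hm => hvT (mem_verts.2 (.inr hm))
  refine ⟨S.eraseSat v, T.insertSat v h, ⟨by omega, by omega⟩, ⟨by omega, by omega⟩,
    by omega, by omega, ?_, ?_⟩
  · rw [verts_eraseSat hv, verts_insertSat]
    rw [Set.disjoint_left] at hd ⊢
    grind
  · rw [verts_eraseSat hv, verts_insertSat]
    ext x
    grind

/-- Satellites of two disjoint stars that are adjacent may be split off as a new `1`-star. -/
lemma splitsInto3AtMostOneT_of_adj_sat {k t : ℕ} (ht : 2 ≤ t) (htk : t < k) {S T : GStar G}
    (hS : S.sats.card = t) (hT : 2 ≤ T.sats.card) (hTk : T.sats.card ≤ k)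
    (hd : Disjoint S.verts T.verts) {u v : V} (hv : v ∈ S.sats) (hu : u ∈ T.sats)
    (h : G.Adj v u) :
    SplitsInto3AtMostOneT G k t (S.verts ∪ T.verts) := by
  have hvS : v ∈ S.verts := mem_verts.2 (.inr hv)
  have huT : u ∈ T.verts := mem_verts.2 (.inr hu)
  have hA := card_eraseSat hv
  have hB := card_eraseSat hu
  have hC := card_ofAdj h
  refine ⟨S.eraseSat v, T.eraseSat u, ofAdj v u h, ⟨by omega, by omega⟩, ⟨by omega, by omega⟩,
    ⟨by omega, by omega⟩, ?_, ?_, ?_, ?_, by omega, by omega, by omega⟩ <;>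
  rw [Set.disjoint_left] at hd
  · rw [verts_eraseSat hv, verts_eraseSat hu, Set.disjoint_left]
    grind
  · rw [verts_eraseSat hv, verts_ofAdj, Set.disjoint_left]
    grind
  · rw [verts_eraseSat hu, verts_ofAdj, Set.disjoint_left]
    grind
  · rw [verts_eraseSat hv, verts_eraseSat hu, verts_ofAdj]
    ext x
    grind

end GStar

lemma mem_coverSet {G : SimpleGraph V} {P : Set (GStar G)} {x : V} :
    x ∈ coverSet P ↔ ∃ S ∈ P, x ∈ S.verts := by
  simp [coverSet]

/-- In an optimal packing, every neighbor of a satellite of a star with at least two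
satellites is covered. -/
lemma IsOptimalKMinusPacking.mem_coverSet_of_adj_sat [Finite V] {G : SimpleGraph V} {k : ℕ}
    {Q : Set (GStar G)} (hQ : IsOptimalKMinusPacking k Q) {S : GStar G} (hS : S ∈ Q)
    (hS2 : 2 ≤ S.sats.card) {u v : V} (hv : v ∈ S.sats) (h : G.Adj v u) : u ∈ coverSet Q := by
  by_contra hu
  have hvS : v ∈ S.verts := GStar.mem_verts.2 (.inr hv)
  have hA := GStar.card_eraseSat hv
  have hu' : ∀ T ∈ Q, u ∉ T.verts := fun T hT hm => hu (mem_coverSet.2 ⟨T, hT, hm⟩)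
  have hSk := (hQ.1.1 S hS).2
  have hdS : ∀ T ∈ Q \ {S}, ∀ x ∈ S.verts, x ∉ T.verts := fun T hT =>
    fun _ hx => Set.disjoint_left.1 (hQ.1.2 hS hT.1 fun e => hT.2 e.symm) hx
  have hle := hQ.2 (insert (S.eraseSat v) (insert (GStar.ofAdj v u h) (Q \ {S}))) ⟨?_, ?_⟩
  · refine absurd hle (not_le.2 (Set.ncard_lt_ncard ((Set.ssubset_iff_of_subset ?_).2
      ⟨u, mem_coverSet.2 ⟨GStar.ofAdj v u h, by simp, GStar.mem_verts_ofAdj h |>.2 (.inr rfl)⟩,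
        hu⟩) (Set.toFinite _)))
    intro x hx
    obtain ⟨T, hT, hxT⟩ := mem_coverSet.1 hx
    by_cases hTS : T = S
    · subst hTS
      by_cases hxv : x = v
      · exact mem_coverSet.2 ⟨GStar.ofAdj v u h, by simp, GStar.mem_verts_ofAdj h |>.2 (.inl hxv)⟩
      · exact mem_coverSet.2 ⟨_, Set.mem_insert _ _, (GStar.mem_verts_eraseSat hv).2 ⟨hxT, hxv⟩⟩
    · exact mem_coverSet.2 ⟨T, by simp [hT, hTS], hxT⟩
  · rintro T (rfl | rfl | hT)
    · omega
    · rw [GStar.card_ofAdj]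
      omega
    · exact hQ.1.1 T hT.1
  · have hsymm : Std.Symm fun S T : GStar G => Disjoint S.verts T.verts :=
      ⟨fun _ _ h => h.symm⟩
    rw [Set.pairwise_insert_of_symm, Set.pairwise_insert_of_symm]
    refine ⟨⟨hQ.1.2.mono Set.sdiff_subset, fun T hT _ => ?_⟩, ?_⟩
    · have := hdS T hT v hvS
      have := hu' T hT.1
      rw [GStar.verts_ofAdj, Set.disjoint_left]
      grind
    · rintro T (rfl | hT) -
      · have := hu' S hS
        rw [GStar.verts_eraseSat hv, GStar.verts_ofAdj, Set.disjoint_left]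
        grind
      · have := hdS T hT
        rw [GStar.verts_eraseSat hv, Set.disjoint_left]
        grind

/-- Lemma 9(2) of the paper: in a Revise-stable optimal `k⁻`-star packing, each satellite
of every `t`-star is adjacent (outside its own star) only to the centers of
`(t-1)`-stars or `k`-stars, except that for `t = 2` it may be adjacent to a vertex of a
`1`-star. -/
theorem tstar_satellite_neighbors [Fintype V] (G : SimpleGraph V) (k t : ℕ)
    (ht : 2 ≤ t) (htk : t < k)
    (Q0 : Set (GStar G)) (hQ0 : IsOptimalKMinusPacking k Q0)
    (hRS : ReviseStable G k t Q0) :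
    ∀ S ∈ Q0, S.sats.card = t → ∀ v ∈ S.sats, ∀ u : V, G.Adj v u → u ∉ S.verts →
      (∃ S' ∈ Q0, S'.center = u ∧ (S'.sats.card = t - 1 ∨ S'.sats.card = k)) ∨
      (t = 2 ∧ ∃ S' ∈ Q0, S'.sats.card = 1 ∧ u ∈ S'.verts) := by
  intro S hS hSt v hv u hvu huS
  obtain ⟨S', hS', huS'⟩ :=
    mem_coverSet.1 (hQ0.mem_coverSet_of_adj_sat hS (by omega) hv hvu)
  have hne : S' ≠ S := by
    rintro rfl
    exact huS huS'
  have hd : Disjoint S.verts S'.verts := hQ0.1.2 hS hS' hne.symm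
  obtain ⟨h2, h3⟩ := hRS.2.1 S hS hSt S' hS' hne
  obtain ⟨hpos, hle⟩ := hQ0.1.1 S' hS'
  rcases GStar.mem_verts.1 huS' with rfl | hu
  · by_contra hcon
    have hcard : ¬ (S'.sats.card = t - 1 ∨ S'.sats.card = k) :=
      fun hc => hcon (.inl ⟨S', hS', rfl, hc⟩)
    exact h2 (GStar.splitsInto2NoT_of_adj_center ht htk hSt (by omega) (by omega) hd hv hvu.symm)
  · by_cases hone : S'.sats.card = 1
    · by_cases ht2 : t = 2
      · exact .inr ⟨ht2, S', hS', hone, huS'⟩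
      · have hadj : G.Adj u S'.center := (S'.adj u hu).symm
        have hverts : (GStar.ofAdj u S'.center hadj).verts = S'.verts := by
          obtain ⟨w, hw⟩ := Finset.card_eq_one.1 hone
          obtain rfl : u = w := by simpa [hw] using hu
          rw [GStar.verts_ofAdj, Set.pair_comm]
          simp [GStar.verts, hw]
        have hcard := GStar.card_ofAdj hadj
        rw [← hverts] at h2 hd
        exact absurd (GStar.splitsInto2NoT_of_adj_center ht htk hSt (by omega) (by omega) hd hv
          hvu.symm) h2
    · exact absurd (GStar.splitsInto3AtMostOneT_of_adj_sat ht htk hSt (by omega) hle hd hv hu hvu)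
        h3
end

section
/- Let G be a finite simple graph, let k > t ≥ 2 be integers, and let Q0 be a Revise-stable optimal k^−-star packing of G. Then for every star S of Q0 with exactly t satellites, every neighbor w in G of the center of S with w ∉ V(S) is covered by Q0 and satisfies: w is a satellite of a star of Q0 having exactly t+1 satellites, or w is the center of a star of Q0, or w belongs to a star of Q0 having exactly one satellite. -/
open SimpleGraph

variable {V : Type*}

open Classical in
/-- The star obtained by attaching a new neighbor of the center as a satellite. -/
noncomputable def GStar.addSat {G : SimpleGraph V} (S : GStar G) (w : V)
    (hw : G.Adj S.center w) : GStar G where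
  center := S.center
  sats := insert w S.sats
  center_not_mem := by
    simp only [Finset.mem_insert, not_or]
    exact ⟨hw.ne, S.center_not_mem⟩
  adj := by
    intro v hv
    rcases Finset.mem_insert.1 hv with rfl | hv
    · exact hw
    · exact S.adj v hv

open Classical in
/-- The star obtained by removing a vertex from the satellites. -/
noncomputable def GStar.eraseSat_s14 {G : SimpleGraph V} (S : GStar G) (w : V) : GStar G where
  center := S.center
  sats := S.sats.erase w
  center_not_mem := fun h => S.center_not_mem (Finset.mem_of_mem_erase h)
  adj := fun v hv => S.adj v (Finset.mem_of_mem_erase hv)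

theorem GStar.verts_addSat {G : SimpleGraph V} (S : GStar G) (w : V)
    (hw : G.Adj S.center w) : (S.addSat w hw).verts = insert w S.verts := by
  simp [GStar.verts, GStar.addSat, Set.insert_comm]

theorem GStar.card_sats_addSat {G : SimpleGraph V} (S : GStar G) (w : V)
    (hw : G.Adj S.center w) (h : w ∉ S.verts) :
    (S.addSat w hw).sats.card = S.sats.card + 1 := by
  classical
  refine (Finset.card_insert_of_notMem fun hm => h ?_)
  exact Set.mem_insert_of_mem _ hm

theorem GStar.verts_eraseSat_s14 {G : SimpleGraph V} (S : GStar G) {w : V} (hw : w ∈ S.sats) :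
    (S.eraseSat_s14 w).verts = S.verts \ {w} := by
  have hne : S.center ≠ w := fun h => S.center_not_mem (h ▸ hw)
  ext x
  simp only [GStar.verts, GStar.eraseSat_s14, Set.mem_insert_iff, Finset.mem_coe,
    Finset.mem_erase, Set.mem_sdiff, Set.mem_singleton_iff]
  grind

theorem GStar.card_sats_eraseSat {G : SimpleGraph V} (S : GStar G) {w : V} (hw : w ∈ S.sats) :
    (S.eraseSat_s14 w).sats.card = S.sats.card - 1 := by
  classical
  exact Finset.card_erase_of_mem hw

/-- In an optimal packing, every neighbor of the center of a star that can still be enlarged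
is covered. -/
theorem IsOptimalKMinusPacking.mem_coverSet_of_adj_center [Finite V] {G : SimpleGraph V} {k : ℕ}
    {Q : Set (GStar G)} (hQ : IsOptimalKMinusPacking k Q) {S : GStar G} (hS : S ∈ Q)
    (hcard : S.sats.card < k) {w : V} (hw : G.Adj S.center w) : w ∈ coverSet Q := by
  by_contra hun
  have hnot : ∀ T ∈ Q, w ∉ T.verts := fun T hT h => hun (Set.mem_biUnion hT h)
  obtain ⟨⟨hok, hdisj⟩, hmax⟩ := hQ
  have hnew : ∀ T ∈ Q, T ≠ S → Disjoint (S.addSat w hw).verts T.verts := by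
    intro T hT hTS
    rw [GStar.verts_addSat, Set.disjoint_insert_left]
    exact ⟨hnot T hT, hdisj hS hT hTS.symm⟩
  have hpack : IsKMinusPacking k (insert (S.addSat w hw) (Q \ {S})) := by
    refine ⟨?_, ?_⟩
    · rintro T (rfl | hT)
      · rw [GStar.card_sats_addSat S w hw (hnot S hS)]
        omega
      · exact hok T hT.1
    · refine (hdisj.mono Set.sdiff_subset).insert ?_
      rintro T ⟨hT, hTS⟩ -
      exact ⟨hnew T hT hTS, (hnew T hT hTS).symm⟩
  have hwmem : w ∈ coverSet (insert (S.addSat w hw) (Q \ {S})) := by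
    refine Set.mem_biUnion (Set.mem_insert _ _) ?_
    rw [GStar.verts_addSat]
    exact Set.mem_insert _ _
  have hsub : coverSet Q ⊆ coverSet (insert (S.addSat w hw) (Q \ {S})) := by
    refine Set.iUnion₂_subset fun T hT x hx => ?_
    by_cases hTS : T = S
    · subst hTS
      refine Set.mem_biUnion (Set.mem_insert _ _) ?_
      rw [GStar.verts_addSat]
      exact Set.mem_insert_of_mem _ hx
    · exact Set.mem_biUnion (Set.mem_insert_of_mem _ ⟨hT, hTS⟩) hx
  have hlt := Set.ncard_lt_ncard ((Set.ssubset_iff_of_subset hsub).2 ⟨w, hwmem, hun⟩)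
    (Set.toFinite _)
  exact absurd (hmax _ hpack) (not_le.2 hlt)

/-- Moving a satellite `w` of `T` to a `t`-star `S` whose center is adjacent to `w` splits
`V(S) ∪ V(T)` into two stars without exactly `t` satellites. -/
theorem splitsInto2NoT_of_adj_center {G : SimpleGraph V} {k t : ℕ} (htk : t < k)
    {S T : GStar G} (hSt : S.sats.card = t) (hT2 : 2 ≤ T.sats.card) (hTk : T.sats.card ≤ k)
    (hTt : T.sats.card ≠ t + 1) (hST : Disjoint S.verts T.verts) {w : V}
    (hw : G.Adj S.center w) (hwT : w ∈ T.sats) : SplitsInto2NoT G k t (S.verts ∪ T.verts) := by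
  have hwTv : w ∈ T.verts := Set.mem_insert_of_mem _ hwT
  have hwS : w ∉ S.verts := fun h => Set.disjoint_left.1 hST h hwTv
  have hA := S.card_sats_addSat w hw hwS
  have hB := T.card_sats_eraseSat hwT
  refine ⟨S.addSat w hw, T.eraseSat_s14 w, ⟨?_, ?_⟩, ⟨?_, ?_⟩, ?_, ?_, ?_, ?_⟩
  iterate 6 omega
  · rw [GStar.verts_addSat, GStar.verts_eraseSat_s14 T hwT, Set.disjoint_insert_left]
    exact ⟨fun h => h.2 rfl, hST.mono_right Set.sdiff_subset⟩
  · rw [GStar.verts_addSat, GStar.verts_eraseSat_s14 T hwT]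
    ext x
    simp only [Set.mem_union, Set.mem_insert_iff, Set.mem_sdiff, Set.mem_singleton_iff]
    grind

/-- Lemma 9(3) of the paper: in a Revise-stable optimal `k⁻`-star packing, each neighbor
(outside its own star) of the center of every `t`-star is covered, and is a satellite of
a `(t+1)`-star, or the center of a star of the packing, or a vertex of a `1`-star. -/
theorem tstar_center_neighbors [Fintype V] (G : SimpleGraph V) (k t : ℕ)
    (ht : 2 ≤ t) (htk : t < k)
    (Q0 : Set (GStar G)) (hQ0 : IsOptimalKMinusPacking k Q0)
    (hRS : ReviseStable G k t Q0) :
    ∀ S ∈ Q0, S.sats.card = t → ∀ w : V, G.Adj S.center w → w ∉ S.verts →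
      w ∈ coverSet Q0 ∧
      ((∃ S' ∈ Q0, S'.sats.card = t + 1 ∧ w ∈ S'.sats) ∨
       (∃ S' ∈ Q0, S'.center = w) ∨
       (∃ S' ∈ Q0, S'.sats.card = 1 ∧ w ∈ S'.verts)) := by
  intro S hS hSt w hw hwS
  have hcov := hQ0.mem_coverSet_of_adj_center hS (hSt ▸ htk) hw
  refine ⟨hcov, ?_⟩
  obtain ⟨T, hT, hwT⟩ := Set.mem_iUnion₂.1 hcov
  by_cases hT1 : T.sats.card = 1
  · exact Or.inr (Or.inr ⟨T, hT, hT1, hwT⟩)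
  rcases hwT with hc | hwsat
  · exact Or.inr (Or.inl ⟨T, hT, hc.symm⟩)
  by_cases hTt : T.sats.card = t + 1
  · exact Or.inl ⟨T, hT, hTt, hwsat⟩
  have hTS : T ≠ S := by
    rintro rfl
    exact hwS (Set.mem_insert_of_mem _ hwsat)
  have hTok := hQ0.1.1 T hT
  exact absurd (splitsInto2NoT_of_adj_center htk hSt (by omega) hTok.2 hTt
    (hQ0.1.2 hS hT hTS.symm) hw hwsat) (hRS.2.1 S hS hSt T hT hTS).1
end

section
/- Let G be a finite simple graph, let k > t ≥ 2 be integers, and let Q0 be a Revise-stable optimal k^−-star packing of G. Then: (a) if t ≥ 3, no two distinct satellites of a single star of Q0 with exactly t satellites are both adjacent in G to the center of one star of Q0 with exactly t−1 satellites; and (b) for any t ≥ 2, there do not exist two distinct stars S and T of Q0, each with exactly t satellites, a satellite of S and a satellite of T that are both adjacent in G to the center of one star of Q0 with exactly t−1 satellites. -/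
open SimpleGraph

variable {V : Type*}

theorem GStar.mem_verts_s17 {G : SimpleGraph V} {S : GStar G} {x : V} :
    x ∈ S.verts ↔ x = S.center ∨ x ∈ S.sats := by
  simp [GStar.verts]

/-- The star obtained from `S` by keeping only the satellites outside `A`. -/
noncomputable def GStar.removeSats {G : SimpleGraph V} (S : GStar G) (A : Finset V) : GStar G :=
  open Classical in
  { center := S.center
    sats := S.sats \ A
    center_not_mem := fun h => S.center_not_mem (Finset.mem_sdiff.1 h).1
    adj := fun v hv => S.adj v (Finset.mem_sdiff.1 hv).1 }

/-- The star obtained from `S` by adding a set `A` of neighbors of its center as satellites. -/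
noncomputable def GStar.addSats {G : SimpleGraph V} (S : GStar G) (A : Finset V)
    (hA : ∀ v ∈ A, G.Adj S.center v) : GStar G :=
  open Classical in
  { center := S.center
    sats := S.sats ∪ A
    center_not_mem := fun h => (Finset.mem_union.1 h).elim S.center_not_mem
      fun h => G.irrefl (hA _ h)
    adj := fun v hv => (Finset.mem_union.1 hv).elim (S.adj v) (hA v) }

theorem GStar.mem_verts_removeSats {G : SimpleGraph V} {S : GStar G} {A : Finset V} {x : V} :
    x ∈ (S.removeSats A).verts ↔ x = S.center ∨ x ∈ S.sats ∧ x ∉ A := by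
  simp [GStar.mem_verts_s17, GStar.removeSats]

theorem GStar.mem_verts_addSats {G : SimpleGraph V} {S : GStar G} {A : Finset V}
    {hA : ∀ v ∈ A, G.Adj S.center v} {x : V} :
    x ∈ (S.addSats A hA).verts ↔ x = S.center ∨ x ∈ S.sats ∨ x ∈ A := by
  simp [GStar.mem_verts_s17, GStar.addSats]

theorem GStar.card_sats_removeSats {G : SimpleGraph V} {S : GStar G} {A : Finset V}
    (hA : A ⊆ S.sats) : (S.removeSats A).sats.card = S.sats.card - A.card := by
  classical
  simp only [GStar.removeSats]
  convert Finset.card_sdiff_of_subset hA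

theorem GStar.card_sats_addSats {G : SimpleGraph V} {S : GStar G} {A : Finset V}
    {hA : ∀ v ∈ A, G.Adj S.center v} (hd : Disjoint S.sats A) :
    (S.addSats A hA).sats.card = S.sats.card + A.card := by
  classical
  simp only [GStar.addSats]
  convert Finset.card_union_of_disjoint hd

/-- In a Revise-stable optimal `k⁻`-star packing: (a) if `t ≥ 3`, no two distinct
satellites of a single `t`-star are both adjacent to the center of one `(t-1)`-star of
the packing; (b) no satellite of one `t`-star and satellite of a different `t`-star are
both adjacent to the center of one `(t-1)`-star of the packing. -/
theorem tstar_satellites_distinct_tminusone_centers [Fintype V] (G : SimpleGraph V)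
    (k t : ℕ) (ht : 2 ≤ t) (htk : t < k)
    (Q0 : Set (GStar G)) (hQ0 : IsOptimalKMinusPacking k Q0)
    (hRS : ReviseStable G k t Q0) :
    (3 ≤ t →
      ¬ ∃ S ∈ Q0, ∃ S' ∈ Q0, S.sats.card = t ∧ S'.sats.card = t - 1 ∧
          ∃ v ∈ S.sats, ∃ w ∈ S.sats, v ≠ w ∧
            G.Adj v S'.center ∧ G.Adj w S'.center) ∧
    (¬ ∃ S ∈ Q0, ∃ T ∈ Q0, ∃ S' ∈ Q0, S ≠ T ∧
        S.sats.card = t ∧ T.sats.card = t ∧ S'.sats.card = t - 1 ∧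
        ∃ v ∈ S.sats, ∃ w ∈ T.sats,
          G.Adj v S'.center ∧ G.Adj w S'.center) := by
  classical
  obtain ⟨⟨-, hdisj⟩, -⟩ := hQ0
  obtain ⟨-, hR2, hR3⟩ := hRS
  refine ⟨?_, ?_⟩
  · rintro ht3 ⟨S, hS, S', hS', hSt, hSt', v, hv, w, hw, hvw, hav, haw⟩
    have hne : S' ≠ S := by
      rintro rfl
      omega
    have hd := Set.disjoint_left.1 (hdisj hS' hS hne)
    simp only [GStar.mem_verts_s17] at hd
    have hsub : ({v, w} : Finset V) ⊆ S.sats := by grind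
    have hadj : ∀ x ∈ ({v, w} : Finset V), G.Adj S'.center x := by
      grind [G.adj_comm]
    have hdis : Disjoint S'.sats {v, w} := by
      rw [Finset.disjoint_left]
      grind
    have h1 := GStar.card_sats_removeSats hsub
    have h2 := GStar.card_sats_addSats (hA := hadj) hdis
    rw [Finset.card_pair hvw] at h1 h2
    refine (hR2 S hS hSt S' hS' hne).1 ⟨S.removeSats {v, w}, S'.addSats {v, w} hadj,
      ⟨by omega, by omega⟩, ⟨by omega, by omega⟩, by omega, by omega, ?_, ?_⟩
    · rw [Set.disjoint_left]
      simp only [GStar.mem_verts_removeSats, GStar.mem_verts_addSats]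
      grind [S.center_not_mem]
    · ext x
      simp only [Set.mem_union, GStar.mem_verts_removeSats, GStar.mem_verts_addSats]
      simp only [GStar.mem_verts_s17]
      grind
  · rintro ⟨S, hS, T, hT, S', hS', hST, hSt, hTt, hSt', v, hv, w, hw, hav, haw⟩
    have hneS : S' ≠ S := by
      rintro rfl
      omega
    have hneT : S' ≠ T := by
      rintro rfl
      omega
    have hdS := Set.disjoint_left.1 (hdisj hS' hS hneS)
    have hdT := Set.disjoint_left.1 (hdisj hS' hT hneT)
    have hdST := Set.disjoint_left.1 (hdisj hS hT hST)
    simp only [GStar.mem_verts_s17] at hdS hdT hdST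
    have hvw : v ≠ w := by grind
    have hadj : ∀ x ∈ ({v, w} : Finset V), G.Adj S'.center x := by
      grind [G.adj_comm]
    have hdis : Disjoint S'.sats {v, w} := by
      rw [Finset.disjoint_left]
      grind
    have h1 := GStar.card_sats_removeSats (Finset.singleton_subset_iff.2 hv)
    have h2 := GStar.card_sats_removeSats (Finset.singleton_subset_iff.2 hw)
    have h3 := GStar.card_sats_addSats (hA := hadj) hdis
    rw [Finset.card_singleton] at h1 h2
    rw [Finset.card_pair hvw] at h3
    refine (hR3 S hS T hT hST hSt hTt S' hS' hneS hneT (Or.inr (Or.inl hSt'))).2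
      ⟨S.removeSats {v}, T.removeSats {w}, S'.addSats {v, w} hadj,
        ⟨by omega, by omega⟩, ⟨by omega, by omega⟩, ⟨by omega, by omega⟩,
        by omega, by omega, by omega, ?_, ?_, ?_, ?_⟩
    · rw [Set.disjoint_left]
      simp only [GStar.mem_verts_removeSats]
      grind
    · rw [Set.disjoint_left]
      simp only [GStar.mem_verts_removeSats, GStar.mem_verts_addSats]
      grind [S.center_not_mem]
    · rw [Set.disjoint_left]
      simp only [GStar.mem_verts_removeSats, GStar.mem_verts_addSats]
      grind [T.center_not_mem]
    · ext x
      simp only [Set.mem_union, GStar.mem_verts_removeSats, GStar.mem_verts_addSats]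
      simp only [GStar.mem_verts_s17]
      grind
end
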